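/- Let k ≥ 2 be a fixed integer. There exists a constant C > 0, depending only on k, such that for every odd prime power q, the Paley sum k-graph P_k(q) satisfies |N*_{P_k(q)}(𝒪_k^e) − q^{2k}/2| ≤ C·q^{2k−1}. -/

import Mathlib

/-- The number of labeled induced even partial octahedrons in the Paley sum `k`-graph
`P_k(q)` on `F_q`: the number of injective maps `u : [k] × {0,1} → F_q` such that the
number of `ε ∈ {0,1}^k` with `u(1,ε_1) + ⋯ + u(k,ε_k)` not a square in `F_q` is even. -/
noncomputable def NEPOPaley (F : Type*) [Field F] [Fintype F] (k : ℕ) : ℕ :=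
  Set.ncard {u : Fin k × Bool → F | Function.Injective u ∧
    Even (Set.ncard {ε : Fin k → Bool | ¬ IsSquare (∑ i : Fin k, u (i, ε i))})}

open Polynomial

section
variable {F : Type*} [Field F]

def Filt (w c : ℕ) (P : F[X][X]) : Prop := ∀ l, (P.coeff l).natDegree ≤ c + l * w

lemma Filt.mul {w c c' : ℕ} {P Q : F[X][X]} (hP : Filt w c P) (hQ : Filt w c' Q) :
    Filt w (c + c') (P * Q) := by
  intro l
  rw [coeff_mul]
  apply natDegree_sum_le_of_forall_le
  rintro ⟨i, j⟩ hij
  rw [Finset.HasAntidiagonal.mem_antidiagonal] at hij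
  simp only at hij ⊢
  refine natDegree_mul_le.trans ?_
  have h1 := hP i
  have h2 := hQ j
  subst hij
  rw [add_mul]; omega

lemma Filt.one {w : ℕ} : Filt w 0 (1 : F[X][X]) := by
  intro l
  rw [coeff_one]; split_ifs <;> simp

lemma Filt.pow {w c : ℕ} {P : F[X][X]} (hP : Filt w c P) (n : ℕ) : Filt w (n * c) (P ^ n) := by
  induction n with
  | zero => simpa using Filt.one
  | succ n ih => rw [pow_succ, Nat.succ_mul]; exact ih.mul hP

lemma Filt.prod {ι : Type*} {w : ℕ} (s : Finset ι) (P : ι → F[X][X]) (h : ∀ i ∈ s, Filt w 0 (P i)) :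
    Filt w 0 (∏ i ∈ s, P i) := by
  classical
  induction s using Finset.induction_on with
  | empty => simpa using Filt.one
  | insert a s ha ih =>
    rw [Finset.prod_insert ha]
    exact (h a (by simp)).mul (ih fun i hi => h i (by simp [hi]))

lemma Filt.C {w c : ℕ} (p : F[X]) (h : p.natDegree ≤ c) : Filt w c (C p) := by
  intro l
  rw [coeff_C]; split_ifs
  · omega
  · simp

lemma Filt.lin {w c : ℕ} (p r : F[X]) (h : p.natDegree ≤ c) (h' : r.natDegree ≤ c + w) :
    Filt w c (Polynomial.C p + Polynomial.C r * X) := by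
  intro l
  rcases l with _ | _ | l
  · simpa using h
  · simpa using h'
  · simp

lemma exists_v {n p : Type*} [Fintype n] [Fintype p] (G : n → p → F)
    (h : Fintype.card p < Fintype.card n) : ∃ v : n → F, v ≠ 0 ∧ ∀ j, ∑ i, v i * G i j = 0 := by
  classical
  have := LinearMap.ker_ne_bot_of_finrank_lt (f := (Matrix.of G).vecMulLinear) (by simpa using h)
  obtain ⟨v, hv, hv0⟩ := (Submodule.ne_bot_iff _).1 this
  refine ⟨v, hv0, fun j => ?_⟩
  have := congrFun (LinearMap.mem_ker.1 hv) j
  simpa [Matrix.vecMul, dotProduct] using this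

lemma not_sq {f A B : F[X]} {c r : F} (hc : c ≠ 0) {h : F[X]} (hf : f = (X - C r) * h)
    (hr : h.eval r ≠ 0) (he : f * A ^ 2 = C c * B ^ 2) : A = 0 ∧ B = 0 := by
  have hh : h ≠ 0 := by rintro rfl; simp at hr
  have hf0 : f ≠ 0 := by rw [hf]; exact mul_ne_zero (X_sub_C_ne_zero r) hh
  by_cases hA : A = 0
  · subst hA
    refine ⟨rfl, ?_⟩
    have : C c * B ^ 2 = 0 := by rw [← he]; simp
    simpa [hc] using this
  · exfalso
    have hl : f * A ^ 2 ≠ 0 := mul_ne_zero hf0 (pow_ne_zero _ hA)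
    have hr' : C c * B ^ 2 ≠ 0 := he ▸ hl
    have h1 := congrArg (rootMultiplicity r) he
    have e1 : rootMultiplicity r h = 0 := rootMultiplicity_eq_zero hr
    have hB : B * B ≠ 0 := by rw [← sq]; exact right_ne_zero_of_mul hr'
    have hA2 : A * A ≠ 0 := mul_ne_zero hA hA
    rw [rootMultiplicity_mul hl, rootMultiplicity_mul hr', sq, sq, rootMultiplicity_mul hB,
      rootMultiplicity_mul hA2, hf, rootMultiplicity_mul (hf ▸ hf0), e1, rootMultiplicity_X_sub_C_self,
      rootMultiplicity_C] at h1
    omega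

variable [Fintype F]

/-- nontriviality -/
lemma nontriv {f : F[X]} {r : F} {h : F[X]} (hf : f = (X - C r) * h)
    (hr : h.eval r ≠ 0) (h0 : f.eval 0 ≠ 0) (hodd : Odd (Fintype.card F)) (D J : ℕ)
    (hD : f.natDegree + 2 * D ≤ Fintype.card F + 1)
    (A B : ℕ → F[X]) (hA : ∀ j, (A j).natDegree < D) (hB : ∀ j, (B j).natDegree < D)
    (hR : ∑ j ∈ Finset.range J, (A j + B j * f ^ (Fintype.card F / 2)) * X ^ (Fintype.card F * j) = 0) :
    ∀ j < J, A j = 0 ∧ B j = 0 := by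
  set q := Fintype.card F with hq
  intro j
  induction j using Nat.strong_induction_on with
  | _ j ih =>
  intro hj
  have split : ∀ A : ℕ → F[X], (∀ i < j, A i = 0) → ∃ P', ∑ i ∈ Finset.range J, A i * X ^ (q * i) =
      X ^ (q * j) * (A j + X ^ q * P') := by
    intro A hA0
    refine ⟨∑ i ∈ Finset.range (J - (j+1)), A (j + 1 + i) * X ^ (q * i), ?_⟩
    have : J = (j + 1) + (J - (j+1)) := by omega
    conv_lhs => rw [this, Finset.sum_range_add, Finset.sum_range_succ]
    rw [Finset.sum_eq_zero (s := Finset.range j), zero_add, mul_add, Finset.mul_sum, Finset.mul_sum]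
    · congr 1
      · ring
      · apply Finset.sum_congr rfl
        intro i _
        ring
    · intro i hi
      rw [hA0 i (Finset.mem_range.1 hi), zero_mul]
  obtain ⟨P', hP'⟩ := split A (fun i hi => (ih i hi (by omega)).1)
  obtain ⟨Q', hQ'⟩ := split B (fun i hi => (ih i hi (by omega)).2)
  have hR2 : X ^ (q * j) * ((A j + X ^ q * P') + f ^ (q/2) * (B j + X ^ q * Q')) = 0 := by
    rw [mul_add, ← hP', mul_left_comm, ← hQ', ← hR, Finset.mul_sum, ← Finset.sum_add_distrib]
    apply Finset.sum_congr rfl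
    intro i _
    ring
  have hR3 := (mul_eq_zero.1 hR2).resolve_left (pow_ne_zero _ X_ne_zero)
  have hfq : f ^ q = C (f.eval 0) + X ^ q * expand F q f.divX := by
    rw [hq, ← FiniteField.expand_card]
    conv_lhs => rw [← divX_mul_X_add f]
    simp [coeff_zero_eq_eval_zero]
    ring
  have hfq2 : f ^ q = f * (f ^ (q / 2)) ^ 2 := by
    obtain ⟨t, ht⟩ := hodd
    have : q / 2 = t := by omega
    rw [this, ht]; ring
  have key : X ^ q ∣ f * A j ^ 2 - C (f.eval 0) * B j ^ 2 := by
    have e1 : A j + X ^ q * P' = - (f ^ (q/2) * (B j + X ^ q * Q')) := eq_neg_of_add_eq_zero_left hR3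
    have e2 : f * (A j + X ^ q * P') ^ 2 = (C (f.eval 0) + X ^ q * expand F q f.divX) * (B j + X ^ q * Q') ^ 2 := by
      rw [← hfq, hfq2, e1]; ring
    have : f * A j ^ 2 - C (f.eval 0) * B j ^ 2 = X ^ q * ( expand F q f.divX * (B j + X ^ q * Q') ^ 2
      + C (f.eval 0) * (2 * B j * Q' + X^q * Q' ^ 2) - f * (2 * A j * P' + X^q * P'^2)) := by
      linear_combination e2
    exact ⟨_, this⟩
  have hz : f * A j ^ 2 - C (f.eval 0) * B j ^ 2 = 0 := by
    apply eq_zero_of_dvd_of_natDegree_lt key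
    rw [natDegree_X_pow]
    have b1 : (f * A j ^ 2).natDegree < q := by
      have := natDegree_mul_le (p := f) (q := A j ^ 2)
      have := natDegree_pow_le (p := A j) (n := 2)
      have := hA j
      omega
    have b2 : (C (f.eval 0) * B j ^ 2).natDegree < q := by
      have := natDegree_C_mul_le (f.eval 0) (B j ^ 2)
      have := natDegree_pow_le (p := B j) (n := 2)
      have := hB j
      have : 1 ≤ f.natDegree := by
        have : f ≠ 0 := by rintro rfl; simp at h0
        rw [hf, natDegree_mul (X_sub_C_ne_zero r) (by rintro rfl; simp at hr)]
        simp
      omega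
    exact (natDegree_sub_le _ _).trans_lt (max_lt b1 b2)
  exact not_sq h0 hf hr (sub_eq_zero.1 hz)

/-- order of vanishing from the local expansion -/
lemma dvd_of_comp {F : Type*} [Field F] {R : F[X]} {x c : F} (hc : c ≠ 0) {M : ℕ}
    (h : X ^ M ∣ R.comp (C x + C c * X)) : (X - C x) ^ M ∣ R := by
  obtain ⟨S, hS⟩ := h
  have h2 := congrArg (fun P => P.comp (C c⁻¹ * (X - C x))) hS
  simp only [comp_assoc] at h2
  have e : (C x + C c * X).comp (C c⁻¹ * (X - C x)) = X := by
    simp only [add_comp, mul_comp, C_comp, X_comp]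
    rw [← mul_assoc, ← C_mul, mul_inv_cancel₀ hc]; simp
  rw [e, comp_X] at h2
  rw [h2]
  simp only [mul_comp, pow_comp, X_comp, mul_pow]
  exact Dvd.dvd.mul_right (Dvd.intro_left _ rfl) _

lemma stepanov {ι : Type*} [Fintype ι] [Nonempty ι] [DecidableEq F] (a : ι → F) (ha : Function.Injective a)
    (ha0 : ∀ i, a i ≠ 0) (b : F) (hodd : Odd (Fintype.card F)) (D J M : ℕ)
    (hM : M ≤ Fintype.card F) (hD : Fintype.card ι + 2 * D ≤ Fintype.card F + 1)
    (hcount : M * (D + J + M * Fintype.card ι) < 2 * J * D) :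
    M * (Finset.univ.filter (fun x : F => ∏ i, (x - a i) ≠ 0 ∧
      (∏ i, (x - a i)) ^ (Fintype.card F / 2) = b)).card ≤
      D + Fintype.card ι * (Fintype.card F / 2) + Fintype.card F * J := by
  classical
  set q := Fintype.card F with hq
  set m := Fintype.card ι with hm
  have hm1 : 1 ≤ m := Fintype.card_pos
  set f : F[X] := ∏ i, (X - C (a i)) with hf
  have hfdeg : f.natDegree = m := by
    rw [hf, natDegree_prod_of_monic _ _ (fun i _ => monic_X_sub_C _)]; simp [hm]
  have hfe : ∀ x, f.eval x = ∏ i, (x - a i) := by intro x; simp [hf, eval_prod]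
  let Y : F[X][X] := C X + C f * X
  let fi : ι → F[X] := fun i => ∏ j ∈ Finset.univ.erase i, (X - C (a j))
  have hfi : ∀ i, f = (X - C (a i)) * fi i := fun i => by
    exact (Finset.mul_prod_erase Finset.univ (fun j => X - C (a j)) (Finset.mem_univ i)).symm
  have hfideg : ∀ i, (fi i).natDegree ≤ m - 1 := by
    intro i
    simp only [fi]
    rw [natDegree_prod_of_monic _ _ (fun i _ => monic_X_sub_C _)]; simp [hm]
  let u : F[X][X] := (∏ i, (C 1 + C (fi i) * X)) ^ (q / 2)
  let N := Fin J × Fin D × Bool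
  let e : N → F[X][X] := fun n => C (X ^ (n.1 : ℕ)) * Y ^ (n.2.1 : ℕ) *
    (if n.2.2 then C (C b) * u else 1)
  let r : N → F[X] := fun n => X ^ (q * (n.1 : ℕ)) * X ^ (n.2.1 : ℕ) *
    (if n.2.2 then f ^ (q / 2) else 1)
  have hY : Filt (m - 1) 1 Y := Filt.lin _ _ (by simp) (by omega)
  have hu : Filt (m - 1) 0 u := by
    have : Filt (m - 1) 0 (∏ i, (C 1 + C (fi i) * X)) := by
      apply Filt.prod
      intro i _
      exact Filt.lin _ _ (by simp) (by simpa using hfideg i)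
    have h2 := this.pow (q / 2)
    rw [mul_zero] at h2
    exact h2
  have he : ∀ n, Filt (m - 1) (n.1 + n.2.1) (e n) := by
    intro n
    have h1 : Filt (m - 1) (n.1 : ℕ) (C ((X : F[X]) ^ (n.1 : ℕ))) := Filt.C _ (by simp)
    have h2 := h1.mul (hY.pow (n.2.1 : ℕ))
    have h3 : Filt (m - 1) 0 (if n.2.2 then C (C b) * u else 1) := by
      split_ifs
      · simpa using (Filt.C (c := 0) (C b) (by simp)).mul hu
      · exact Filt.one
    have h4 := h2.mul h3
    rw [mul_one, add_zero] at h4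
    exact h4
  set K := D + J + M * m with hK
  obtain ⟨v, hv0, hv⟩ := exists_v (n := N) (p := Fin M × Fin K)
    (fun n p => ((e n).coeff p.1).coeff p.2) (by
      simp only [N, Fintype.card_prod, Fintype.card_fin, Fintype.card_bool]
      calc _ < _ := hcount
        _ = _ := by ring)
  let Q : F[X][X] := ∑ n, C (C (v n)) * e n
  let R : F[X] := ∑ n, C (v n) * r n
  have hQ : ∀ l < M, Q.coeff l = 0 := by
    intro l hl
    ext i
    simp only [Q, finsetSum_coeff, coeff_C_mul, coeff_zero]
    by_cases hi : i < K
    · exact hv (⟨l, hl⟩, ⟨i, hi⟩)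
    · apply Finset.sum_eq_zero
      intro n _
      rw [coeff_eq_zero_of_natDegree_lt, mul_zero]
      have h1 := he n l
      have h2 := n.1.2
      have h3 := n.2.1.2
      have h4 : l * (m - 1) ≤ M * m := Nat.mul_le_mul hl.le (by omega)
      omega
  have hQd : X ^ M ∣ Q := X_pow_dvd_iff.2 hQ
  -- degree of R
  have hRdeg : R.natDegree ≤ D + m * (q / 2) + q * J := by
    apply natDegree_sum_le_of_forall_le
    intro n _
    refine (natDegree_C_mul_le _ _).trans ?_
    simp only [r]
    refine natDegree_mul_le.trans ?_
    rw [← pow_add, natDegree_X_pow]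
    have h1 : (if n.2.2 then f ^ (q / 2) else 1).natDegree ≤ m * (q / 2) := by
      split_ifs
      · refine natDegree_pow_le.trans ?_
        rw [hfdeg, mul_comm]
      · simp
    have h3 := n.2.1.2
    have h4 : q * n.1 ≤ q * J := Nat.mul_le_mul le_rfl n.1.2.le
    omega
  -- R nonzero
  have hR0 : R ≠ 0 := by
    intro hR
    apply hv0
    obtain ⟨i0⟩ := ‹Nonempty ι›
    let A : Bool → ℕ → F[X] := fun t j => if hj : j < J then
      ∑ d : Fin D, C (v (⟨j, hj⟩, d, t)) * X ^ (d : ℕ) else 0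
    by_cases hJ : J = 0
    · subst hJ; funext n; exact n.1.elim0
    by_cases hD0 : D = 0
    · subst hD0; funext n; exact n.2.1.elim0
    have hA : ∀ t j, (A t j).natDegree < D := by
      intro t j
      simp only [A]
      split_ifs
      · apply (natDegree_sum_le_of_forall_le (n := D - 1) _ _ _).trans_lt (by omega)
        intro d _
        refine (natDegree_C_mul_X_pow_le _ _).trans ?_
        omega
      · simp; omega
    have := nontriv (hfi i0) (by
      simp only [fi, eval_prod, eval_sub, eval_X, eval_C]
      rw [Finset.prod_ne_zero_iff]
      intro j hj
      rw [Finset.mem_erase] at hj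
      exact sub_ne_zero.2 fun h => hj.1 (ha h).symm) (by
      rw [hfe, Finset.prod_ne_zero_iff]
      intro j hj
      simpa using ha0 j) hodd D J (by rw [hfdeg]; exact hD) (A false) (A true) (hA _) (hA _) (by
      rw [← hR, Finset.sum_range]
      simp only [R, N, Fintype.sum_prod_type, A, r]
      apply Finset.sum_congr rfl
      intro j _
      simp only [j.2, dif_pos, Fin.eta]
      rw [add_mul, Finset.sum_mul, Finset.sum_mul, Finset.sum_mul, ← Finset.sum_add_distrib]
      apply Finset.sum_congr rfl
      intro d _
      simp
      ring)
    funext n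
    obtain ⟨j, d, t⟩ := n
    have hz : A t j = 0 := by
      cases t
      · exact (this j j.2).1
      · exact (this j j.2).2
    have := congrArg (fun p => p.coeff (d : ℕ)) hz
    simp only [A, j.2, dif_pos, Fin.eta, finsetSum_coeff, coeff_C_mul, coeff_X_pow] at this
    rw [Finset.sum_eq_single d] at this
    · simpa using this
    · intro d' _ hd
      rw [if_neg (fun h => hd (Fin.ext h.symm)), mul_zero]
    · intro h; exact absurd (Finset.mem_univ d) h
  -- vanishing
  have hvan : ∀ x, f.eval x ≠ 0 → (f.eval x) ^ (q / 2) = b → (X - C x) ^ M ∣ R := by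
    intro x hx hxb
    apply dvd_of_comp hx
    let ψ : F[X][X] →+* F[X] := mapRingHom (evalRingHom x)
    let φ : F[X] →+* F[X] := compRingHom (C x + C (f.eval x) * X)
    have hψY : ψ Y = C x + C (f.eval x) * X := by simp [ψ, Y]
    have hφX : φ X = C x + C (f.eval x) * X := by simp [φ]
    have hφC : ∀ c, φ (C c) = C c := by simp [φ]
    have hφf : φ f = C (f.eval x) * ψ (∏ i, (C 1 + C (fi i) * X)) := by
      rw [map_prod, hf, map_prod, eval_prod, map_prod, ← Finset.prod_mul_distrib]
      apply Finset.prod_congr rfl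
      intro i _
      rw [map_sub, hφX, hφC, hfi i]
      simp [ψ]
      ring
    have hφg : φ (f ^ (q / 2)) = C b * ψ u := by
      rw [map_pow, hφf, mul_pow, ← map_pow ψ, ← C_pow, hxb]
    have hXq : (C x + C (f.eval x) * X) ^ q = C x + C (f.eval x) * X ^ q := by
      rw [hq, ← FiniteField.expand_card]
      simp
    have hterm : ∀ n, X ^ M ∣ φ (r n) - ψ (e n) := by
      intro n
      have e1 : φ (r n) - ψ (e n) = ((C x + C (f.eval x) * X ^ q) ^ (n.1 : ℕ) - C x ^ (n.1 : ℕ)) *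
          ((C x + C (f.eval x) * X) ^ (n.2.1 : ℕ) * (if n.2.2 then C b * ψ u else 1)) := by
        have e2 : ψ (C (X ^ (n.1 : ℕ))) = C x ^ (n.1 : ℕ) := by simp [ψ]
        have e3 : ψ (C (C b)) = C b := by simp [ψ]
        simp only [r, e]
        rw [map_mul, map_mul, map_mul, map_mul, e2, map_pow φ, map_pow φ, map_pow ψ, hψY, hφX, pow_mul, hXq]
        split_ifs
        · rw [hφg, map_mul, e3]; ring
        · rw [map_one, map_one]; ring
      rw [e1]
      apply Dvd.dvd.mul_right
      refine dvd_trans ?_ (sub_dvd_pow_sub_pow _ _ _)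
      rw [add_sub_cancel_left]
      exact Dvd.dvd.mul_left (pow_dvd_pow _ hM) _
    have h1 : X ^ M ∣ ψ Q := by
      have := map_dvd ψ hQd
      simpa [ψ] using this
    have h2 : φ R = ψ Q + ∑ n, C (v n) * (φ (r n) - ψ (e n)) := by
      simp only [R, Q, map_sum, map_mul, hφC]
      rw [← Finset.sum_add_distrib]
      apply Finset.sum_congr rfl
      intro n _
      have : ψ (C (C (v n))) = C (v n) := by simp [ψ]
      rw [this]; ring
    change X ^ M ∣ φ R
    rw [h2]
    exact dvd_add h1 (Finset.dvd_sum fun n _ => Dvd.dvd.mul_left (hterm n) _)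
  have hprod : ∏ x ∈ (Finset.univ.filter (fun x : F => ∏ i, (x - a i) ≠ 0 ∧
      (∏ i, (x - a i)) ^ (q / 2) = b)), (X - C x) ^ M ∣ R := by
    apply Finset.prod_dvd_of_coprime
    · intro x _ y _ hxy
      exact (isCoprime_X_sub_C_of_isUnit_sub (sub_ne_zero.2 hxy).isUnit).pow
    · intro x hx
      rw [Finset.mem_filter, ← hfe] at hx
      exact hvan x hx.2.1 hx.2.2
  have := natDegree_le_of_dvd hprod hR0
  rw [natDegree_prod_of_monic _ _ (fun x _ => (monic_X_sub_C _).pow _)] at this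
  simp only [natDegree_pow, natDegree_X_sub_C, mul_one, Finset.sum_const, smul_eq_mul] at this
  rw [mul_comm]
  exact this.trans hRdeg

lemma count_bound {ι : Type*} [Fintype ι] [Nonempty ι] [DecidableEq F] (a : ι → F) (ha : Function.Injective a)
    (ha0 : ∀ i, a i ≠ 0) (b : F) (hodd : Odd (Fintype.card F))
    (hM : 8 * (Fintype.card ι + 1) ≤ Nat.sqrt (Fintype.card F)) :
    2 * (Finset.univ.filter (fun x : F => ∏ i, (x - a i) ≠ 0 ∧
      (∏ i, (x - a i)) ^ (Fintype.card F / 2) = b)).card ≤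
      Fintype.card F + (20 * Fintype.card ι + 24) * Nat.sqrt (Fintype.card F) := by
  have key := stepanov a ha ha0 b hodd
  generalize (Finset.univ.filter (fun x : F => ∏ i, (x - a i) ≠ 0 ∧
      (∏ i, (x - a i)) ^ (Fintype.card F / 2) = b)).card = S at key ⊢
  generalize Fintype.card F = q at *
  have hm1 : 1 ≤ Fintype.card ι := Fintype.card_pos
  generalize Fintype.card ι = m at *
  have h1 := Nat.sqrt_le q
  have h2 := Nat.sqrt_le_add q
  generalize Nat.sqrt q = M at *
  have hMq : M ≤ q := (Nat.le_mul_self M).trans h1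
  obtain ⟨D, hD⟩ : ∃ D, D = (q - m) / 2 := ⟨_, rfl⟩
  obtain ⟨J, hJ⟩ : ∃ J, J = (M + 1) / 2 + (2 * m + 2) := ⟨_, rfl⟩
  have d1 : q ≤ 2 * D + m + 1 := by omega
  have d2 : 2 * D + m ≤ q := by omega
  have j1 : M + 4 * m + 4 ≤ 2 * J := by omega
  have j2 : 2 * J ≤ M + 4 * m + 5 := by omega
  have := key D J M hMq (by omega) (by
    have e1 : (M + 4 * m + 4) * (2 * D) ≤ 2 * J * (2 * D) := Nat.mul_le_mul j1 le_rfl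
    have e2 : M * (2 * J) ≤ M * (M + 4 * m + 5) := Nat.mul_le_mul le_rfl j2
    have e3 : (4 * m + 4) * q ≤ (4 * m + 4) * (2 * D + m + 1) := Nat.mul_le_mul le_rfl d1
    have e4 : (2 * m) * (M * M) ≤ (2 * m) * q := Nat.mul_le_mul le_rfl h1
    have e5 : 8 * (m + 1) * M ≤ M * M := Nat.mul_le_mul hM le_rfl
    have e6 : 8 * (m + 1) * (m + 1) ≤ M * (m + 1) := Nat.mul_le_mul hM le_rfl
    nlinarith)
  have hMpos : 0 < M := by omega
  have q2 : 2 * (q / 2) ≤ q := by omega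
  have e1 : m * (2 * (q / 2)) ≤ m * q := Nat.mul_le_mul le_rfl q2
  have e2 : q * (2 * J) ≤ q * (M + 4 * m + 5) := Nat.mul_le_mul le_rfl j2
  have e3 : (5 * m + 6) * q ≤ (5 * m + 6) * (M * M + M + M) := Nat.mul_le_mul le_rfl h2
  have e4 : (5 * m + 6) * (M + M) ≤ (5 * m + 6) * (M * M) := by
    apply Nat.mul_le_mul le_rfl; nlinarith
  refine Nat.le_of_mul_le_mul_left ?_ hMpos
  nlinarith

open Classical in
noncomputable def etaS {F : Type*} [Field F] (x : F) : ℤ := if IsSquare x then 1 else -1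

lemma prod_eta {F : Type*} [Field F] {ι : Type*} (s : Finset ι) (g : ι → F) :
    ∏ i ∈ s, etaS (g i) = 1 ∨ ∏ i ∈ s, etaS (g i) = -1 := by
  classical
  induction s using Finset.induction_on with
  | empty => simp
  | insert a s ha ih =>
    rw [Finset.prod_insert ha]
    have : etaS (g a) = 1 ∨ etaS (g a) = -1 := by unfold etaS; split_ifs <;> simp
    rcases this with h | h <;> rcases ih with h' | h' <;> simp [h, h']

lemma eta_cast (hodd : Odd (Fintype.card F)) {x : F} (hx : x ≠ 0) :
    ((etaS x : ℤ) : F) = x ^ (Fintype.card F / 2) := by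
  have hF : ringChar F ≠ 2 := by
    intro h
    have := FiniteField.even_card_iff_char_two.1 h
    rw [Nat.odd_iff] at hodd; omega
  unfold etaS
  have h1 := FiniteField.isSquare_iff hF hx
  rcases FiniteField.pow_dichotomy hF hx with h | h
  · rw [if_pos (h1.2 h), h]; simp
  · rw [if_neg, h]
    · simp
    · rw [h1, h]
      intro h'
      exact Ring.neg_one_ne_one_of_char_ne_two hF h'

lemma weil0 {ι : Type*} [Fintype ι] [Nonempty ι] (s : ι → F) (hs : Function.Injective s)
    (hs0 : ∀ i, s i ≠ 0) (hodd : Odd (Fintype.card F))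
    (hM : 8 * (Fintype.card ι + 1) ≤ Nat.sqrt (Fintype.card F)) :
    |∑ x, ∏ i, etaS (x + s i)| ≤ (22 * Fintype.card ι + 24) * Nat.sqrt (Fintype.card F) := by
  classical
  have hb : ∀ b : ℤ, 2 * (Finset.univ.filter (fun x : F => ∏ i, etaS (x + s i) = b)).card ≤
      Fintype.card F + (20 * Fintype.card ι + 24) * Nat.sqrt (Fintype.card F) + 2 * Fintype.card ι := by
    intro b
    have h1 := count_bound (fun i => - s i) (fun i j h => hs (neg_injective h))
      (fun i => neg_ne_zero.2 (hs0 i)) (b : F) hodd hM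
    simp only [sub_neg_eq_add] at h1
    have h2 : (Finset.univ.filter (fun x : F => ∏ i, etaS (x + s i) = b)) ⊆
      (Finset.univ.filter (fun x : F => ∏ i, (x + s i) ≠ 0 ∧
      (∏ i, (x + s i)) ^ (Fintype.card F / 2) = b)) ∪ Finset.univ.image (fun i => - s i) := by
      intro x hx
      rw [Finset.mem_filter] at hx
      rw [Finset.mem_union]
      by_cases h0 : ∏ i, (x + s i) = 0
      · right
        obtain ⟨i, _, hi⟩ := Finset.prod_eq_zero_iff.1 h0
        rw [Finset.mem_image]
        exact ⟨i, Finset.mem_univ _, (eq_neg_of_add_eq_zero_left hi).symm⟩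
      · left
        rw [Finset.mem_filter]
        refine ⟨Finset.mem_univ _, h0, ?_⟩
        rw [← hx.2, Int.cast_prod, ← Finset.prod_pow]
        apply Finset.prod_congr rfl
        intro i _
        exact (eta_cast hodd (Finset.prod_ne_zero_iff.1 h0 i (Finset.mem_univ i))).symm
    have h3 := (Finset.card_le_card h2).trans (Finset.card_union_le _ _)
    have h4 : (Finset.univ.image (fun i => - s i)).card ≤ Fintype.card ι := Finset.card_image_le
    omega
  have hT : ∀ b : ℤ, b = 1 ∨ b = -1 → b * ∑ x, ∏ i, etaS (x + s i) =
      2 * (Finset.univ.filter (fun x : F => ∏ i, etaS (x + s i) = b)).card - Fintype.card F := by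
    intro b hb
    have : ∀ x : F, b * ∏ i, etaS (x + s i) = 2 * (if ∏ i, etaS (x + s i) = b then 1 else 0) - 1 := by
      intro x
      rcases hb with rfl | rfl <;> rcases prod_eta Finset.univ (fun i => x + s i) with h | h <;>
        rw [h] <;> norm_num
    rw [Finset.mul_sum, Finset.sum_congr rfl (fun x _ => this x), Finset.sum_sub_distrib, ← Finset.mul_sum]
    simp
  have hm1 : 1 ≤ Fintype.card ι := Fintype.card_pos
  have a1 := hT 1 (by simp)
  have a2 := hT (-1) (by simp)
  have b1 := hb 1
  have b2 := hb (-1)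
  zify at b1 b2 hM hm1
  generalize (∑ x, ∏ i, etaS (x + s i)) = T at *
  have : (Fintype.card ι : ℤ) ≤ Fintype.card ι * Nat.sqrt (Fintype.card F) := by nlinarith
  rw [abs_le]
  constructor <;> nlinarith

lemma weil {ι : Type*} [Fintype ι] [Nonempty ι] (s : ι → F) (hs : Function.Injective s)
    (hodd : Odd (Fintype.card F)) :
    (∑ x, ∏ i, etaS (x + s i)) ^ 2 ≤ (22 * Fintype.card ι + 24 : ℤ) ^ 2 * Fintype.card F := by
  classical
  by_cases hM : 8 * (Fintype.card ι + 1) ≤ Nat.sqrt (Fintype.card F)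
  · have hq : Fintype.card ι < Fintype.card F := by
      have := Nat.sqrt_le_self (Fintype.card F); omega
    obtain ⟨c, hc⟩ : ∃ c, c ∉ Finset.univ.image (fun i => - s i) := by
      by_contra! h
      have h1 : Finset.univ.image (fun i => - s i) = Finset.univ := Finset.eq_univ_iff_forall.2 h
      have h2 : (Finset.univ.image (fun i => - s i)).card ≤ Fintype.card ι := Finset.card_image_le
      rw [h1, Finset.card_univ] at h2
      omega
    have h := weil0 (fun i => c + s i) (fun i j h => hs (add_left_cancel h)) (fun i hi => hc (by
      rw [Finset.mem_image]
      exact ⟨i, Finset.mem_univ _, (eq_neg_of_add_eq_zero_left hi).symm⟩)) hodd hM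
    have e : ∑ x, ∏ i, etaS (x + (c + s i)) = ∑ x, ∏ i, etaS (x + s i) := by
      rw [← Equiv.sum_comp (Equiv.addRight c) (fun x => ∏ i, etaS (x + s i))]
      simp [add_assoc]
    rw [e] at h
    have h1 := Nat.sqrt_le (Fintype.card F)
    zify at h1
    calc _ = |∑ x, ∏ i, etaS (x + s i)| ^ 2 := (sq_abs _).symm
      _ ≤ ((22 * Fintype.card ι + 24) * Nat.sqrt (Fintype.card F) : ℤ) ^ 2 := by gcongr
      _ = (22 * Fintype.card ι + 24 : ℤ) ^ 2 * ((Nat.sqrt (Fintype.card F)) * (Nat.sqrt (Fintype.card F))) := by ring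
      _ ≤ _ := by gcongr
  · have h : |∑ x, ∏ i, etaS (x + s i)| ≤ Fintype.card F := by
      refine (Finset.abs_sum_le_sum_abs _ _).trans ?_
      calc _ ≤ ∑ x : F, (1 : ℤ) := Finset.sum_le_sum fun x _ => by
            rcases prod_eta Finset.univ (fun i => x + s i) with h | h <;> rw [h] <;> simp
        _ = _ := by simp
    have h2 := Nat.lt_succ_sqrt (Fintype.card F)
    have h3 : (Nat.sqrt (Fintype.card F) + 1) ≤ 22 * Fintype.card ι + 24 := by omega
    have h4 : Fintype.card F ≤ (22 * Fintype.card ι + 24) ^ 2 := by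
      rw [sq]; exact h2.le.trans (Nat.mul_le_mul h3 h3)
    zify at h4
    calc _ = |∑ x, ∏ i, etaS (x + s i)| ^ 2 := (sq_abs _).symm
      _ ≤ (Fintype.card F : ℤ) ^ 2 := by gcongr
      _ = Fintype.card F * Fintype.card F := sq _
      _ ≤ _ := by gcongr

lemma card_det {ι : Type*} [Fintype ι] [DecidableEq ι] (Z : Finset (ι → F)) (i0 : ι)
    (h : ∀ u ∈ Z, ∀ v ∈ Z, (∀ i, i ≠ i0 → u i = v i) → u i0 = v i0) :
    Z.card ≤ Fintype.card F ^ (Fintype.card ι - 1) := by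
  classical
  have : Z.card ≤ (Finset.univ : Finset ({i // i ≠ i0} → F)).card := by
    apply Finset.card_le_card_of_injOn (fun u i => u i.1) (by simp)
    intro u hu v hv huv
    have h1 : ∀ i, i ≠ i0 → u i = v i := fun i hi => congrFun huv ⟨i, hi⟩
    funext i
    by_cases hi : i = i0
    · subst hi; exact h u hu v hv h1
    · exact h1 i hi
  simpa [Fintype.card_subtype_compl] using this

lemma card_noninj (ι : Type*) [Fintype ι] [DecidableEq ι] [DecidableEq F]
    [DecidablePred fun u : ι → F => ¬ Function.Injective u] :
    (Finset.univ.filter (fun u : ι → F => ¬ Function.Injective u)).card ≤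
      Fintype.card ι ^ 2 * Fintype.card F ^ (Fintype.card ι - 1) := by
  classical
  have : (Finset.univ.filter (fun u : ι → F => ¬ Function.Injective u)) ⊆
      (Finset.univ : Finset (ι × ι)).biUnion
        (fun p => Finset.univ.filter (fun u : ι → F => p.1 ≠ p.2 ∧ u p.1 = u p.2)) := by
    intro u hu
    have hu := (Finset.mem_filter.1 hu).2
    unfold Function.Injective at hu
    push Not at hu
    obtain ⟨i, j, h, hij⟩ := hu
    simp only [Finset.mem_biUnion, Finset.mem_filter, Finset.mem_univ, true_and]
    exact ⟨(i, j), hij, h⟩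
  refine (Finset.card_le_card this).trans ((Finset.card_biUnion_le_card_mul _ _
    (Fintype.card F ^ (Fintype.card ι - 1)) ?_).trans ?_)
  · rintro ⟨i, j⟩ _
    apply card_det _ i
    intro u hu v hv h
    simp only [Finset.mem_filter, Finset.mem_univ, true_and] at hu hv
    rw [hu.2, hv.2]
    exact h j hu.1.symm
  · simp [sq]

lemma card_coinc (k : ℕ) [DecidablePred fun s : Fin k × Bool → F =>
      ¬ Function.Injective (fun ε : Fin k → Bool => ∑ i, s (i, ε i))] :
    (Finset.univ.filter (fun s : Fin k × Bool → F =>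
      ¬ Function.Injective (fun ε : Fin k → Bool => ∑ i, s (i, ε i)))).card ≤
      (2 ^ k) ^ 2 * Fintype.card F ^ (2 * k - 1) := by
  classical
  have : (Finset.univ.filter (fun s : Fin k × Bool → F =>
      ¬ Function.Injective (fun ε : Fin k → Bool => ∑ i, s (i, ε i)))) ⊆
      (Finset.univ : Finset ((Fin k → Bool) × (Fin k → Bool))).biUnion
        (fun p => Finset.univ.filter (fun s : Fin k × Bool → F =>
          p.1 ≠ p.2 ∧ ∑ i, s (i, p.1 i) = ∑ i, s (i, p.2 i))) := by
    intro u hu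
    have hu := (Finset.mem_filter.1 hu).2
    unfold Function.Injective at hu
    push Not at hu
    obtain ⟨i, j, h, hij⟩ := hu
    simp only [Finset.mem_biUnion, Finset.mem_filter, Finset.mem_univ, true_and]
    exact ⟨(i, j), hij, h⟩
  refine (Finset.card_le_card this).trans ((Finset.card_biUnion_le_card_mul _ _
    (Fintype.card F ^ (2 * k - 1)) ?_).trans ?_)
  · rintro ⟨ε, δ⟩ _
    by_cases hne : ε = δ
    · subst hne; simp
    obtain ⟨i0, hi0⟩ := Function.ne_iff.1 hne
    have := card_det (Finset.univ.filter (fun s : Fin k × Bool → F =>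
          ε ≠ δ ∧ ∑ i, s (i, ε i) = ∑ i, s (i, δ i))) (i0, ε i0) (by
      intro u hu v hv h
      simp only [Finset.mem_filter, Finset.mem_univ, true_and] at hu hv
      have e1 : ∑ i, u (i, δ i) = ∑ i, v (i, δ i) := by
        apply Finset.sum_congr rfl
        intro i _
        apply h
        rintro h'
        rw [Prod.mk.injEq] at h'
        obtain ⟨rfl, h'⟩ := h'
        exact hi0 h'.symm
      have e2 : ∑ i, u (i, ε i) = ∑ i, v (i, ε i) := by rw [hu.2, hv.2, e1]
      rw [← Finset.add_sum_erase _ _ (Finset.mem_univ i0),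
        ← Finset.add_sum_erase _ (fun i => v (i, ε i)) (Finset.mem_univ i0)] at e2
      rw [Finset.sum_congr rfl (fun i hi => h (i, ε i) (fun h' => by
        rw [Prod.mk.injEq] at h'
        exact (Finset.mem_erase.1 hi).1 h'.1))] at e2
      exact add_right_cancel e2)
    simpa [mul_comm k 2] using this
  · simp [sq]

lemma sum_split (k : ℕ) [DecidableEq F] :
    ∑ u : Fin (k + 1) × Bool → F, ∏ ε : Fin (k + 1) → Bool, etaS (∑ i, u (i, ε i)) =
    ∑ s : Fin k × Bool → F, (∑ x : F, ∏ ε : Fin k → Bool, etaS (x + ∑ i, s (i, ε i))) ^ 2 := by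
  let E : ((F × F) × (Fin k × Bool → F)) ≃ (Fin (k + 1) × Bool → F) :=
    { toFun := fun p q => Fin.cases (if q.2 then p.1.2 else p.1.1) (fun i => p.2 (i, q.2)) q.1
      invFun := fun u => ((u (0, false), u (0, true)), fun q => u (q.1.succ, q.2))
      left_inv := by
        rintro ⟨⟨x, y⟩, s⟩
        simp
      right_inv := by
        intro u
        funext ⟨i, b⟩
        refine Fin.cases ?_ (fun i => ?_) i
        · cases b <;> simp
        · simp }
  rw [← Equiv.sum_comp E, Fintype.sum_prod_type_right]
  apply Finset.sum_congr rfl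
  intro s _
  rw [sq, Finset.sum_mul_sum, Fintype.sum_prod_type]
  apply Finset.sum_congr rfl
  intro x _
  apply Finset.sum_congr rfl
  intro y _
  rw [← Equiv.prod_comp (Fin.consEquiv (fun _ : Fin (k + 1) => Bool)), Fintype.prod_prod_type,
    Fintype.prod_bool, mul_comm]
  simp [E, Fin.sum_univ_succ, Fin.consEquiv]

lemma main_sum (k : ℕ) (hk : 1 ≤ k) [DecidableEq F] (hodd : Odd (Fintype.card F)) :
    |∑ u : Fin (k + 1) × Bool → F, ∏ ε : Fin (k + 1) → Bool, etaS (∑ i, u (i, ε i))| ≤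
    ((22 * 2 ^ k + 24) ^ 2 + (2 ^ k) ^ 2) * (Fintype.card F : ℤ) ^ (2 * k + 1) := by
  classical
  rw [sum_split, abs_of_nonneg (Finset.sum_nonneg fun _ _ => sq_nonneg _)]
  have hb : ∀ s : Fin k × Bool → F,
    (∑ x : F, ∏ ε : Fin k → Bool, etaS (x + ∑ i, s (i, ε i))) ^ 2 ≤
      (22 * 2 ^ k + 24 : ℤ) ^ 2 * Fintype.card F +
      (if ¬ Function.Injective (fun ε : Fin k → Bool => ∑ i, s (i, ε i)) then 1 else 0) *
        (Fintype.card F : ℤ) ^ 2 := by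
    intro s
    by_cases h : Function.Injective (fun ε : Fin k → Bool => ∑ i, s (i, ε i))
    · have := weil _ h hodd
      simpa [h] using this
    · rw [if_pos h, one_mul]
      have h : |∑ x : F, ∏ ε : Fin k → Bool, etaS (x + ∑ i, s (i, ε i))| ≤ Fintype.card F := by
        refine (Finset.abs_sum_le_sum_abs _ _).trans ?_
        calc _ ≤ ∑ x : F, (1 : ℤ) := Finset.sum_le_sum fun x _ => by
              rcases prod_eta Finset.univ (fun ε : Fin k → Bool => x + ∑ i, s (i, ε i)) with h | h <;>
                rw [h] <;> simp
          _ = _ := by simp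
      have h2 : |∑ x : F, ∏ ε : Fin k → Bool, etaS (x + ∑ i, s (i, ε i))| ^ 2 ≤ (Fintype.card F : ℤ) ^ 2 := by
        gcongr
      rw [sq_abs] at h2
      have : (0 : ℤ) ≤ (22 * 2 ^ k + 24 : ℤ) ^ 2 * Fintype.card F := by positivity
      linarith
  refine (Finset.sum_le_sum fun s _ => hb s).trans ?_
  rw [Finset.sum_add_distrib, ← Finset.sum_mul _ _ ((Fintype.card F : ℤ) ^ 2), Finset.sum_boole]
  have hc := card_coinc (F := F) k
  zify at hc
  simp only [Finset.sum_const, Finset.card_univ, Fintype.card_pi, Finset.prod_const, Fintype.card_prod,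
    Fintype.card_fin, Fintype.card_bool, nsmul_eq_mul]
  obtain ⟨t, rfl⟩ : ∃ t, k = t + 1 := ⟨k - 1, by omega⟩
  have e : 2 * (t + 1) - 1 = 2 * t + 1 := by omega
  rw [e] at hc
  push_cast
  calc _ ≤ ((Fintype.card F : ℤ) ^ ((t + 1) * 2)) * ((22 * 2 ^ (t + 1) + 24) ^ 2 * Fintype.card F) +
      ((2 ^ (t + 1)) ^ 2 * (Fintype.card F : ℤ) ^ (2 * t + 1)) * (Fintype.card F : ℤ) ^ 2 := by
        gcongr
    _ = _ := by ring

lemma even_iff_prod (k : ℕ) (u : Fin k × Bool → F) :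
    Even (Set.ncard {ε : Fin k → Bool | ¬ IsSquare (∑ i : Fin k, u (i, ε i))}) ↔
    ∏ ε : Fin k → Bool, etaS (∑ i, u (i, ε i)) = 1 := by
  classical
  have h : ∏ ε : Fin k → Bool, etaS (∑ i, u (i, ε i)) =
      (-1) ^ (Set.ncard {ε : Fin k → Bool | ¬ IsSquare (∑ i : Fin k, u (i, ε i))}) := by
    have h1 : ∀ x : F, etaS x = (-1) ^ (if ¬ IsSquare x then 1 else 0) := by
      intro x
      unfold etaS
      by_cases hx : IsSquare x <;> simp [hx]
    simp only [h1]
    rw [Finset.prod_pow_eq_pow_sum, Finset.sum_boole, Set.ncard_eq_toFinset_card']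
    simp
  rw [h]
  rcases Nat.even_or_odd (Set.ncard {ε : Fin k → Bool | ¬ IsSquare (∑ i : Fin k, u (i, ε i))}) with h | h
  · simp [h, h.neg_one_pow]
  · simp [h, h.neg_one_pow]

lemma count_int (k : ℕ) (hk : 1 ≤ k) (hodd : Odd (Fintype.card F)) :
    |2 * (NEPOPaley F (k + 1) : ℤ) - (Fintype.card F : ℤ) ^ (2 * (k + 1))| ≤
    ((22 * 2 ^ k + 24) ^ 2 + (2 ^ k) ^ 2 + 2 * ((k + 1) * 2) ^ 2) * (Fintype.card F : ℤ) ^ (2 * k + 1) := by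
  classical
  have hN : NEPOPaley F (k + 1) = (Finset.univ.filter (fun u : Fin (k + 1) × Bool → F =>
      Function.Injective u ∧ ∏ ε : Fin (k + 1) → Bool, etaS (∑ i, u (i, ε i)) = 1)).card := by
    unfold NEPOPaley
    rw [← Set.ncard_coe_finset]
    congr 1
    ext u
    simp [even_iff_prod]
  set N' := (Finset.univ.filter (fun u : Fin (k + 1) × Bool → F =>
      ∏ ε : Fin (k + 1) → Bool, etaS (∑ i, u (i, ε i)) = 1)).card with hN'
  have h1 : NEPOPaley F (k + 1) ≤ N' := by
    rw [hN]
    apply Finset.card_le_card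
    intro u
    simp only [Finset.mem_filter]
    tauto
  have h2 : N' ≤ NEPOPaley F (k + 1) +
      (Finset.univ.filter (fun u : Fin (k + 1) × Bool → F => ¬ Function.Injective u)).card := by
    rw [hN]
    refine (Finset.card_le_card ?_).trans (Finset.card_union_le _ _)
    intro u
    simp only [Finset.mem_filter, Finset.mem_union]
    tauto
  have h3 := card_noninj (F := F) (Fin (k + 1) × Bool)
  have e3 : Fintype.card (Fin (k + 1) × Bool) = (k + 1) * 2 := by simp
  have e4 : (k + 1) * 2 - 1 = 2 * k + 1 := by omega
  rw [e3, e4] at h3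
  have h4 : 2 * (N' : ℤ) - (Fintype.card F : ℤ) ^ (2 * (k + 1)) =
      ∑ u : Fin (k + 1) × Bool → F, ∏ ε : Fin (k + 1) → Bool, etaS (∑ i, u (i, ε i)) := by
    have : ∀ u : Fin (k + 1) × Bool → F, ∏ ε : Fin (k + 1) → Bool, etaS (∑ i, u (i, ε i)) =
        2 * (if ∏ ε : Fin (k + 1) → Bool, etaS (∑ i, u (i, ε i)) = 1 then 1 else 0) - 1 := by
      intro u
      rcases prod_eta Finset.univ (fun ε : Fin (k + 1) → Bool => ∑ i, u (i, ε i)) with h | h <;>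
        rw [h] <;> norm_num
    rw [Finset.sum_congr rfl (fun u _ => this u), Finset.sum_sub_distrib, ← Finset.mul_sum,
      Finset.sum_boole]
    simp [hN', mul_comm]
  have h5 := main_sum (F := F) k hk hodd
  rw [← h4, abs_le] at h5
  zify at h1 h2 h3
  rw [abs_le]
  constructor <;> nlinarith
end

theorem stmt_1 (k : ℕ) (hk : 2 ≤ k) :
    ∃ C : ℝ, 0 < C ∧
      ∀ (q : ℕ) (F : Type) [Field F] [Fintype F],
        Fintype.card F = q → Odd q →
          |(NEPOPaley F k : ℝ) - (q : ℝ) ^ (2 * k) / 2| ≤ C * (q : ℝ) ^ (2 * k - 1) := by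
  obtain ⟨t, rfl⟩ : ∃ t, k = t + 1 := ⟨k - 1, by omega⟩
  refine ⟨((22 * 2 ^ t + 24) ^ 2 + (2 ^ t) ^ 2 + 2 * ((t + 1) * 2) ^ 2) / 2, by positivity, ?_⟩
  intro q F _ _ hq hodd
  subst hq
  have h := count_int (F := F) t (by omega) hodd
  have e : 2 * (t + 1) - 1 = 2 * t + 1 := by omega
  rw [e]
  have h' : |2 * (NEPOPaley F (t + 1) : ℝ) - (Fintype.card F : ℝ) ^ (2 * (t + 1))| ≤
    ((22 * 2 ^ t + 24) ^ 2 + (2 ^ t) ^ 2 + 2 * ((t + 1) * 2) ^ 2) * (Fintype.card F : ℝ) ^ (2 * t + 1) := by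
    exact_mod_cast h
  rw [abs_le] at h' ⊢
  constructor <;> linarith
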